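/- Assume hypotheses (H1)–(H4) with constants d and b, and let S > 0 satisfy |f(t, 0)| ≤ S for every t ∈ [0,T] (where 0 denotes the zero function on [−r,0]). Then for every λ ∈ (0,1) and every absolutely continuous x : [0,T] → ℝ with x(0) = x(T) (extended to [−r,0) by x(s) := x(s+T)) satisfying x′(t) + B·β(t−δ)·x′(t−δ)/β(t) = λ·f(t, β_t x_t)/β(t) for almost every t ∈ [0,T], one has the L²-estimate ‖x′‖₂ ≤ (b·d·k₀ + S)·√T/(k₀ − b·T·k₀ − B·K₀), where ‖x′‖₂ := (∫₀^T x′(t)² dt)^{1/2}. -/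

import Mathlib

open MeasureTheory Set Filter
open scoped ENNReal

/-- The function `β` determined by the impulse moments `ts 1 < ⋯ < ts m` and the jump
coefficients `bs 1, …, bs m`: it equals `∏_{k : ts k < t} (1 + bs k)` on `(ts 1, T - δ)`
and `1` elsewhere. -/
noncomputable def impBeta (ts bs : ℕ → ℝ) (m : ℕ) (T δ : ℝ) (t : ℝ) : ℝ :=
  if ts 1 < t ∧ t < T - δ then
    ∏ k ∈ (Finset.Icc 1 m).filter (fun k => ts k < t), (1 + bs k)
  else 1

/-- `x` is absolutely continuous on `[a,b]` with Lebesgue-integrable (a.e.) derivative `g`. -/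
def AbsContOn (x g : ℝ → ℝ) (a b : ℝ) : Prop :=
  MeasureTheory.IntegrableOn g (Set.Icc a b) ∧
    ∀ t ∈ Set.Icc a b, x t = x a + ∫ s in a..t, g s

/-- `x` is absolutely continuous on the half-open interval `(a,b]` with derivative `g`. -/
def AbsContOnIoc (x g : ℝ → ℝ) (a b : ℝ) : Prop :=
  MeasureTheory.IntegrableOn g (Set.Ioc a b) ∧
    ∀ s ∈ Set.Ioc a b, ∀ t ∈ Set.Ioc a b, x t = x s + ∫ u in s..t, g u

/-- `φ` is regulated on `[a,b]`: it has finite left limits on `(a,b]` and finite right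
limits on `[a,b)`. -/
def RegulatedOn (φ : ℝ → ℝ) (a b : ℝ) : Prop :=
  (∀ τ ∈ Set.Ioc a b, ∃ L : ℝ, Filter.Tendsto φ (nhdsWithin τ (Set.Ico a τ)) (nhds L)) ∧
    (∀ τ ∈ Set.Ico a b, ∃ L : ℝ, Filter.Tendsto φ (nhdsWithin τ (Set.Ioc τ b)) (nhds L))

/-- The periodic extension convention `x(s) := x(s + T)` for `s < 0`. -/
noncomputable def pext (T : ℝ) (x : ℝ → ℝ) (s : ℝ) : ℝ := if s < 0 then x (s + T) else x s

lemma aux_shift {T δ : ℝ} {h : ℝ → ℝ} (hp : Function.Periodic h T) :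
    ∫ t in (0:ℝ)..T, h (t - δ) = ∫ t in (0:ℝ)..T, h t := by
  rw [intervalIntegral.integral_comp_sub_right]
  have := hp.intervalIntegral_add_eq (0 - δ) 0
  rw [zero_add] at this
  rw [← this]
  congr 1
  ring

lemma aux_shift_int {T δ : ℝ} (hT : 0 < T) {h : ℝ → ℝ} (hp : Function.Periodic h T)
    (hi : IntervalIntegrable h volume 0 T) :
    IntervalIntegrable (fun t => h (t - δ)) volume 0 T := by
  have := (hp.intervalIntegrable₀ hT.ne' hi (0 - δ) (T - δ)).comp_sub_right δ
  simpa using this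

lemma aux_pos {B δ T k K : ℝ} (hT : 0 < T) (hB : 0 ≤ B) (hk : 0 < k) (hkK : k ≤ K)
    (hBk : B < k / K) (G β : ℝ → ℝ) (hG : Function.Periodic G T) (hβ : Function.Periodic β T)
    (hβm : Measurable β) (hβk : ∀ t, k ≤ β t) (hβK : ∀ t, β t ≤ K)
    (hGi : IntervalIntegrable G volume 0 T)
    (hF : ∀ᵐ t, t ∈ Ioc 0 T → 0 < G t + B * G (t - δ)) :
    0 < ∫ t in (0:ℝ)..T, (β t)⁻¹ * G t := by
  have hK : 0 < K := hk.trans_le hkK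
  have hβp : ∀ t, 0 < β t := fun t => hk.trans_le (hβk t)
  have hinv1 : ∀ t, (β t)⁻¹ ≤ k⁻¹ := fun t => inv_anti₀ hk (hβk t)
  have hinv2 : ∀ t, K⁻¹ ≤ (β t)⁻¹ := fun t => inv_anti₀ (hβp t) (hβK t)
  have hbd : ∀ (c : ℝ) (h : ℝ → ℝ), IntervalIntegrable h volume 0 T →
      IntervalIntegrable (fun t => (β (t + c))⁻¹ * h t) volume 0 T := by
    intro c h hh
    rw [intervalIntegrable_iff] at hh ⊢
    refine Integrable.bdd_mul (c := k⁻¹) hh ?_ ?_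
    · exact ((hβm.comp (measurable_id.add_const c)).inv).aestronglyMeasurable
    · refine Eventually.of_forall fun t => ?_
      rw [Real.norm_eq_abs, abs_of_pos (inv_pos.2 (hβp _))]
      exact hinv1 _
  have hGd := aux_shift_int (δ := δ) hT hG hGi
  set F : ℝ → ℝ := fun t => G t + B * G (t - δ) with hFdef
  have hFi : IntervalIntegrable F volume 0 T := hGi.add (hGd.const_mul B)
  have hF' : ∀ᵐ t ∂(volume.restrict (Ioc 0 T)), 0 < F t :=
    (ae_restrict_iff' measurableSet_Ioc).2 hF
  have hΦ : 0 < ∫ t in (0:ℝ)..T, F t := by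
    rw [intervalIntegral.integral_of_le hT.le]
    have h0 : 0 ≤ᵐ[volume.restrict (Ioc 0 T)] F := hF'.mono fun t ht => ht.le
    refine lt_of_le_of_ne (integral_nonneg_of_ae h0) fun h => ?_
    rw [eq_comm, integral_eq_zero_iff_of_nonneg_ae h0
      ((intervalIntegrable_iff_integrableOn_Ioc_of_le hT.le).1 hFi)] at h
    have hfalse : ∀ᵐ t ∂(volume.restrict (Ioc 0 T)), False := by
      filter_upwards [h, hF'] with t h1 h2
      simp at h1
      linarith
    rw [eventually_false_iff_eq_bot, ae_eq_bot, Measure.restrict_eq_zero] at hfalse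
    simp at hfalse
    linarith
  set Φ := ∫ t in (0:ℝ)..T, F t
  set a : ℕ → ℝ := fun n => ∫ t in (0:ℝ)..T, (β (t + n * δ))⁻¹ * G t with ha
  have hrec : ∀ n : ℕ, ∫ t in (0:ℝ)..T, (β (t + n * δ))⁻¹ * F t = a n + B * a (n + 1) := by
    intro n
    have e1 : ∫ t in (0:ℝ)..T, (β (t + n * δ))⁻¹ * G (t - δ) = a (n + 1) := by
      have hp : Function.Periodic (fun t => (β (t + (n + 1 : ℕ) * δ))⁻¹ * G t) T := by
        intro t
        have := hβ (t + (n + 1 : ℕ) * δ)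
        simp only [hG t]
        rw [← this]
        congr 3
        ring
      rw [ha]
      simp only
      rw [← aux_shift (δ := δ) hp]
      congr 1
      ext t
      congr 3
      push_cast
      ring
    rw [← e1, ← intervalIntegral.integral_const_mul, ha]
    simp only
    rw [← intervalIntegral.integral_add (hbd _ _ hGi) ((hbd _ _ hGd).const_mul B)]
    congr 1
    ext t
    simp only [hFdef]
    ring
  have hlo : ∀ n : ℕ, K⁻¹ * Φ ≤ ∫ t in (0:ℝ)..T, (β (t + n * δ))⁻¹ * F t := by
    intro n
    rw [← intervalIntegral.integral_const_mul]
    refine intervalIntegral.integral_mono_ae_restrict hT.le (hFi.const_mul _) (hbd _ _ hFi) ?_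
    rw [← restrict_Ioc_eq_restrict_Icc]
    filter_upwards [hF'] with t ht
    exact mul_le_mul_of_nonneg_right (hinv2 _) ht.le
  have hhi : ∀ n : ℕ, ∫ t in (0:ℝ)..T, (β (t + n * δ))⁻¹ * F t ≤ k⁻¹ * Φ := by
    intro n
    rw [← intervalIntegral.integral_const_mul]
    refine intervalIntegral.integral_mono_ae_restrict hT.le (hbd _ _ hFi) (hFi.const_mul _) ?_
    rw [← restrict_Ioc_eq_restrict_Icc]
    filter_upwards [hF'] with t ht
    exact mul_le_mul_of_nonneg_right (hinv1 _) ht.le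
  set c : ℝ := (K⁻¹ - B * k⁻¹) * Φ with hc
  have hcpos : 0 < c := by
    refine mul_pos ?_ hΦ
    rw [lt_div_iff₀ hK] at hBk
    rw [sub_pos, ← div_eq_mul_inv, div_lt_iff₀ hk, inv_mul_eq_div, lt_div_iff₀ hK]
    exact hBk
  have hB1 : B < 1 := hBk.trans_le ((div_le_one hK).2 hkK)
  have hstep : ∀ n, c + B ^ 2 * a (n + 2) ≤ a n := by
    intro n
    have h1 := hrec n
    have h2 := hrec (n + 1)
    have h3 := hlo n
    have h4 := hhi (n + 1)
    have h5 : a n = (∫ t in (0:ℝ)..T, (β (t + n * δ))⁻¹ * F t)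
        - B * (∫ t in (0:ℝ)..T, (β (t + (n + 1 : ℕ) * δ))⁻¹ * F t) + B ^ 2 * a (n + 2) := by
      rw [h1, h2]; ring
    have h6 := mul_le_mul_of_nonneg_left h4 hB
    rw [h5, hc]
    nlinarith
  set M : ℝ := k⁻¹ * ∫ t in (0:ℝ)..T, |G t| with hM
  have hbdd : ∀ n, -M ≤ a n := by
    intro n
    have h1 : |a n| ≤ ∫ t in (0:ℝ)..T, |(β (t + n * δ))⁻¹ * G t| :=
      intervalIntegral.abs_integral_le_integral_abs hT.le
    have h2 : ∫ t in (0:ℝ)..T, |(β (t + n * δ))⁻¹ * G t| ≤ M := by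
      rw [hM, ← intervalIntegral.integral_const_mul]
      refine intervalIntegral.integral_mono_on hT.le (hbd _ _ hGi).abs (hGi.abs.const_mul _) ?_
      intro t _
      rw [abs_mul, abs_of_pos (inv_pos.2 (hβp _))]
      exact mul_le_mul_of_nonneg_right (hinv1 _) (abs_nonneg _)
    exact (abs_le.1 (h1.trans h2)).1
  have hbb : BddBelow (range a) := ⟨-M, by rintro _ ⟨n, rfl⟩; exact hbdd n⟩
  have hinf : c + B ^ 2 * (⨅ n, a n) ≤ ⨅ n, a n := by
    refine le_ciInf fun n => le_trans ?_ (hstep n)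
    have := mul_le_mul_of_nonneg_left (ciInf_le hbb (n + 2)) (sq_nonneg B)
    linarith
  have hB2 : B ^ 2 < 1 := by nlinarith
  have hinfpos : 0 < ⨅ n, a n := by
    by_contra hcon
    push Not at hcon
    nlinarith
  have h0 := ciInf_le hbb 0
  have h00 : a 0 = ∫ t in (0:ℝ)..T, (β t)⁻¹ * G t := by simp [ha]
  linarith

lemma aux_CS {T : ℝ} (hT : 0 < T) {h : ℝ → ℝ} (hi : IntervalIntegrable h volume 0 T)
    (hi2 : IntervalIntegrable (fun t => h t ^ 2) volume 0 T) :
    ∫ t in (0:ℝ)..T, |h t| ≤ √T * √(∫ t in (0:ℝ)..T, h t ^ 2) := by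
  rw [← Real.sqrt_mul hT.le]
  apply Real.le_sqrt_of_sq_le
  set I := ∫ t in (0:ℝ)..T, |h t| with hI
  have h0 : 0 ≤ ∫ t in (0:ℝ)..T, (h t ^ 2 - 2 * (I / T) * |h t| + (I / T) ^ 2) := by
    refine intervalIntegral.integral_nonneg hT.le fun t _ => ?_
    have : h t ^ 2 - 2 * (I / T) * |h t| + (I / T) ^ 2 = (|h t| - I / T) ^ 2 := by
      rw [sub_sq, sq_abs]; ring
    rw [this]; positivity
  rw [intervalIntegral.integral_add (hi2.sub (hi.abs.const_mul _)) (by simp),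
    intervalIntegral.integral_sub hi2 (hi.abs.const_mul _),
    intervalIntegral.integral_const_mul, ← hI] at h0
  simp only [intervalIntegral.integral_const, sub_zero, smul_eq_mul] at h0
  have e : T * (I / T) ^ 2 = I * (I / T) := by field_simp
  rw [e] at h0
  have h1 : I * (I / T) ≤ ∫ t in (0:ℝ)..T, h t ^ 2 := by linarith
  have h2 := mul_le_mul_of_nonneg_left h1 hT.le
  have e2 : T * (I * (I / T)) = I ^ 2 := by field_simp
  linarith

lemma aux_L2 {T α C : ℝ} (hT : 0 < T) (hα : 0 ≤ α) (hC : 0 ≤ C) {g h : ℝ → ℝ}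
    (hi : IntervalIntegrable h volume 0 T)
    (hg2 : IntervalIntegrable (fun t => g t ^ 2) volume 0 T)
    (hi2 : IntervalIntegrable (fun t => h t ^ 2) volume 0 T)
    (heq : ∫ t in (0:ℝ)..T, h t ^ 2 = ∫ t in (0:ℝ)..T, g t ^ 2)
    (hle : ∀ᵐ t, t ∈ Icc 0 T → |g t| ≤ α * |h t| + C) :
    √(∫ t in (0:ℝ)..T, g t ^ 2) ≤ α * √(∫ t in (0:ℝ)..T, g t ^ 2) + C * √T := by
  have hcs := aux_CS hT hi hi2
  rw [heq] at hcs
  have hnn : 0 ≤ ∫ t in (0:ℝ)..T, g t ^ 2 :=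
    intervalIntegral.integral_nonneg hT.le fun t _ => sq_nonneg _
  set N := √(∫ t in (0:ℝ)..T, g t ^ 2) with hN
  have hN2 : N ^ 2 = ∫ t in (0:ℝ)..T, g t ^ 2 := Real.sq_sqrt hnn
  have hN0 : 0 ≤ N := Real.sqrt_nonneg _
  have hs2 : √T ^ 2 = T := Real.sq_sqrt hT.le
  have hmono : ∫ t in (0:ℝ)..T, g t ^ 2 ≤
      ∫ t in (0:ℝ)..T, (α ^ 2 * h t ^ 2 + 2 * α * C * |h t| + C ^ 2) := by
    refine intervalIntegral.integral_mono_ae_restrict hT.le hg2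
      (((hi2.const_mul _).add (hi.abs.const_mul _)).add (by simp)) ?_
    refine (ae_restrict_iff' measurableSet_Icc).2 ?_
    filter_upwards [hle] with t ht hmem
    have h1 := ht hmem
    have h2 : |g t| ^ 2 ≤ (α * |h t| + C) ^ 2 := by gcongr
    rw [sq_abs] at h2
    have h3 : (α * |h t| + C) ^ 2 = α ^ 2 * |h t| ^ 2 + 2 * α * C * |h t| + C ^ 2 := by ring
    rw [h3, sq_abs] at h2
    exact h2
  rw [intervalIntegral.integral_add ((hi2.const_mul _).add (hi.abs.const_mul _)) (by simp),
    intervalIntegral.integral_add (hi2.const_mul _) (hi.abs.const_mul _),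
    intervalIntegral.integral_const_mul, intervalIntegral.integral_const_mul, heq, ← hN2] at hmono
  simp only [intervalIntegral.integral_const, sub_zero, smul_eq_mul] at hmono
  have hx := mul_le_mul_of_nonneg_left hcs (show 0 ≤ 2 * α * C by positivity)
  have hfin : N ^ 2 ≤ (α * N + C * √T) ^ 2 := by
    have : (α * N + C * √T) ^ 2 = α ^ 2 * N ^ 2 + 2 * α * C * (√T * N) + √T ^ 2 * C ^ 2 := by ring
    rw [this, hs2]
    linarith
  exact le_of_sq_le_sq hfin (by positivity)

lemma beta_eq (ts bs : ℕ → ℝ) (m : ℕ) (T δ : ℝ) (t : ℝ) : impBeta ts bs m T δ t =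
    1 + (if ts 1 < t then 1 else 0) * ((if T - δ ≤ t then 0 else 1) *
      ((∏ k ∈ Finset.Icc 1 m, (1 + (if ts k < t then 1 else 0) * bs k)) - 1)) := by
  unfold impBeta
  rw [Finset.prod_filter]
  have : ∀ k, (if ts k < t then 1 + bs k else 1) = (1 + (if ts k < t then 1 else 0) * bs k) := by
    intro k; split_ifs <;> simp
  simp only [this]
  by_cases h1 : ts 1 < t <;> by_cases h2 : t < T - δ <;> simp [h1, h2, not_le.2, not_lt.1]

lemma beta_meas (ts bs : ℕ → ℝ) (m : ℕ) (T δ : ℝ) : Measurable (impBeta ts bs m T δ) := by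
  have hi : ∀ c : ℝ, Measurable (fun t : ℝ => if c < t then (1:ℝ) else 0) := fun c =>
    Measurable.ite measurableSet_Ioi measurable_const measurable_const
  have hi2 : ∀ c : ℝ, Measurable (fun t : ℝ => if c ≤ t then (0:ℝ) else 1) := fun c =>
    Measurable.ite measurableSet_Ici measurable_const measurable_const
  have : impBeta ts bs m T δ = fun t => _ := funext (beta_eq ts bs m T δ)
  rw [this]
  refine measurable_const.add ((hi _).mul ((hi2 _).mul (Measurable.sub ?_ measurable_const)))
  exact Finset.measurable_fun_prod _ fun k _ => measurable_const.add ((hi _).mul measurable_const)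

lemma beta_lim (ts bs : ℕ → ℝ) (m : ℕ) (T δ : ℝ) (l : Filter ℝ) (t0 : ℝ)
    (hl : l = nhdsWithin t0 (Iio t0) ∨ l = nhdsWithin t0 (Ioi t0)) :
    ∃ L, Tendsto (impBeta ts bs m T δ) l (nhds L) := by
  have hi : ∀ c : ℝ, (∀ᶠ t in l, c < t) ∨ (∀ᶠ t in l, t < c) := by
    intro c
    rcases hl with rfl | rfl
    · rcases lt_or_ge c t0 with h | h
      · exact Or.inl (nhdsWithin_le_nhds (lt_mem_nhds h))
      · right
        filter_upwards [self_mem_nhdsWithin] with t ht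
        exact lt_of_lt_of_le ht h
    · rcases le_or_gt c t0 with h | h
      · left
        filter_upwards [self_mem_nhdsWithin] with t ht
        exact lt_of_le_of_lt h ht
      · exact Or.inr (nhdsWithin_le_nhds (gt_mem_nhds h))
  have h1 : ∀ c : ℝ, ∃ L, Tendsto (fun t : ℝ => if c < t then (1:ℝ) else 0) l (nhds L) := by
    intro c
    rcases hi c with h | h
    · exact ⟨1, tendsto_const_nhds.congr' (h.mono fun t ht => by simp [ht])⟩
    · exact ⟨0, tendsto_const_nhds.congr' (h.mono fun t ht => by simp [ht.le])⟩
  have h2 : ∀ c : ℝ, ∃ L, Tendsto (fun t : ℝ => if c ≤ t then (0:ℝ) else 1) l (nhds L) := by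
    intro c
    rcases hi c with h | h
    · exact ⟨0, tendsto_const_nhds.congr' (h.mono fun t ht => by simp [ht.le])⟩
    · exact ⟨1, tendsto_const_nhds.congr' (h.mono fun t ht => by simp [ht])⟩
  have : impBeta ts bs m T δ = fun t => _ := funext (beta_eq ts bs m T δ)
  rw [this]
  choose L1 hL1 using h1
  choose L2 hL2 using h2
  exact ⟨_, tendsto_const_nhds.add ((hL1 _).mul ((hL2 _).mul (Tendsto.sub
    (tendsto_finsetProd _ fun k _ => tendsto_const_nhds.add ((hL1 _).mul tendsto_const_nhds))
    tendsto_const_nhds)))⟩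

lemma beta_pos (ts bs : ℕ → ℝ) (m : ℕ) (T δ : ℝ) (hbk : ∀ k, 1 ≤ k → k ≤ m → -1 < bs k) (t : ℝ) :
    0 < impBeta ts bs m T δ t := by
  unfold impBeta
  split_ifs
  · refine Finset.prod_pos fun k hk => ?_
    simp only [Finset.mem_filter, Finset.mem_Icc] at hk
    linarith [hbk k hk.1.1 hk.1.2]
  · norm_num

lemma beta_fin (ts bs : ℕ → ℝ) (m : ℕ) (T δ : ℝ) : (range (impBeta ts bs m T δ)).Finite := by
  refine Set.Finite.subset (s := insert 1 ((fun A : Finset ℕ => ∏ k ∈ A, (1 + bs k)) ''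
    ((Finset.Icc 1 m).powerset : Set (Finset ℕ)))) ?_ ?_
  · exact ((Finset.finite_toSet _).image _).insert 1
  · rintro _ ⟨t, rfl⟩
    unfold impBeta
    split_ifs
    · right
      exact ⟨_, Finset.mem_coe.2 (Finset.mem_powerset.2 (Finset.filter_subset _ _)), rfl⟩
    · exact Or.inl rfl

lemma reg_of_cont {φ : ℝ → ℝ} {a b : ℝ} (h : ContinuousOn φ (Icc a b)) : RegulatedOn φ a b := by
  constructor
  · intro τ hτ
    exact ⟨_, (h τ ⟨hτ.1.le, hτ.2⟩).mono_left
      (nhdsWithin_mono _ fun s hs => ⟨hs.1, hs.2.le.trans hτ.2⟩)⟩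
  · intro τ hτ
    exact ⟨_, (h τ ⟨hτ.1, hτ.2.le⟩).mono_left
      (nhdsWithin_mono _ fun s hs => ⟨hτ.1.trans hs.1.le, hs.2⟩)⟩

lemma reg_mul {φ ψ : ℝ → ℝ} {a b : ℝ} (h : RegulatedOn φ a b) (h' : RegulatedOn ψ a b) :
    RegulatedOn (fun t => φ t * ψ t) a b := by
  constructor
  · intro τ hτ
    obtain ⟨L, hL⟩ := h.1 τ hτ
    obtain ⟨L', hL'⟩ := h'.1 τ hτ
    exact ⟨_, hL.mul hL'⟩
  · intro τ hτ
    obtain ⟨L, hL⟩ := h.2 τ hτ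
    obtain ⟨L', hL'⟩ := h'.2 τ hτ
    exact ⟨_, hL.mul hL'⟩

lemma reg_beta (ts bs : ℕ → ℝ) (m : ℕ) (T δ a b t : ℝ) :
    RegulatedOn (fun τ => impBeta ts bs m T δ (t + τ)) a b := by
  constructor
  · intro τ _
    obtain ⟨L, hL⟩ := beta_lim ts bs m T δ _ (t + τ) (Or.inl rfl)
    refine ⟨L, hL.comp ?_⟩
    refine tendsto_nhdsWithin_iff.2 ⟨?_, ?_⟩
    · exact ((continuous_const.add continuous_id).tendsto τ).mono_left nhdsWithin_le_nhds
    · filter_upwards [self_mem_nhdsWithin] with s hs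
      simpa using hs.2
  · intro τ _
    obtain ⟨L, hL⟩ := beta_lim ts bs m T δ _ (t + τ) (Or.inr rfl)
    refine ⟨L, hL.comp ?_⟩
    refine tendsto_nhdsWithin_iff.2 ⟨?_, ?_⟩
    · exact ((continuous_const.add continuous_id).tendsto τ).mono_left nhdsWithin_le_nhds
    · filter_upwards [self_mem_nhdsWithin] with s hs
      simpa using hs.1

/-- `T`-periodic extension of a function from `[0,T)`. -/
noncomputable def perExt (T : ℝ) (h : ℝ → ℝ) (t : ℝ) : ℝ := h (Int.fract (t / T) * T)

lemma perExt_periodic {T : ℝ} (hT : 0 < T) (h : ℝ → ℝ) : Function.Periodic (perExt T h) T := by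
  intro t
  unfold perExt
  rw [add_div, div_self hT.ne', Int.fract_add_one]

lemma perExt_eq {T : ℝ} (hT : 0 < T) (h : ℝ → ℝ) {t : ℝ} (ht : t ∈ Ico 0 T) :
    perExt T h t = h t := by
  unfold perExt
  rw [Int.fract_eq_self.2 ⟨div_nonneg ht.1 hT.le, (div_lt_one hT).2 ht.2⟩]
  congr 1
  field_simp

lemma perExt_pext {T : ℝ} (hT : 0 < T) (h : ℝ → ℝ) {t : ℝ} (ht : t ∈ Ico (-T) T) :
    perExt T h t = pext T h t := by
  unfold pext
  split_ifs with h0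
  · rw [← perExt_periodic hT h t]
    exact perExt_eq hT h ⟨by linarith [ht.1], by linarith⟩
  · exact perExt_eq hT h ⟨not_lt.1 h0, ht.2⟩

lemma perExt_meas {T : ℝ} {h : ℝ → ℝ} (hm : Measurable h) : Measurable (perExt T h) :=
  hm.comp ((measurable_fract.comp (measurable_id.div_const T)).mul_const T)

lemma pext_cont {T : ℝ} (hT : 0 < T) {x : ℝ → ℝ} (hx : ContinuousOn x (Icc 0 T)) (hp : x 0 = x T) :
    ContinuousOn (pext T x) (Icc (-T) T) := by
  have h1 : ContinuousOn (pext T x) (Icc (-T) 0) := by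
    have : ContinuousOn (fun s => x (s + T)) (Icc (-T) 0) :=
      hx.comp (by fun_prop) fun s hs => ⟨by linarith [hs.1], by linarith [hs.2]⟩
    refine this.congr fun s hs => ?_
    unfold pext
    split_ifs with h
    · rfl
    · have : s = 0 := le_antisymm hs.2 (not_lt.1 h)
      simp [this, hp]
  have h2 : ContinuousOn (pext T x) (Icc 0 T) := by
    refine hx.congr fun s hs => ?_
    unfold pext
    rw [if_neg (not_lt.2 hs.1)]
  have := h1.union_of_isClosed h2 isClosed_Icc isClosed_Icc
  rwa [Icc_union_Icc_eq_Icc (by linarith) hT.le] at this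

lemma perExt_ae {T : ℝ} (hT : 0 < T) (h : ℝ → ℝ) :
    h =ᵐ[volume.restrict (uIoc 0 T)] perExt T h := by
  rw [uIoc_of_le hT.le]
  refine (ae_restrict_iff' measurableSet_Ioc).2 ?_
  filter_upwards [(Set.countable_singleton T).ae_notMem volume] with t ht hm
  exact (perExt_eq hT h ⟨hm.1.le, lt_of_le_of_ne hm.2 ht⟩).symm

lemma perExt_int {T : ℝ} (hT : 0 < T) {h : ℝ → ℝ} (hi : IntervalIntegrable h volume 0 T) :
    IntervalIntegrable (perExt T h) volume 0 T :=
  hi.congr_ae (perExt_ae hT h)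

lemma perExt_integral {T : ℝ} (hT : 0 < T) (h : ℝ → ℝ) :
    ∫ t in (0:ℝ)..T, perExt T h t = ∫ t in (0:ℝ)..T, h t :=
  intervalIntegral.integral_congr_ae_restrict (perExt_ae hT h).symm


/-- The `L²` estimate for the derivative of any periodic solution of `Lx = λ Nx`:
`‖x'‖₂ ≤ (b·d·k₀ + S)·√T/(k₀ - b·T·k₀ - B·K₀)`. -/
theorem statement10
    (B r δ T : ℝ) (m : ℕ) (ts bs : ℕ → ℝ) (f : ℝ → (ℝ → ℝ) → ℝ)
    (hδ0 : 0 ≤ δ) (hδr : δ < r) (hrT : r ≤ T) (hB0 : 0 ≤ B)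
    (hm : 1 ≤ m) (ht1 : 0 < ts 1)
    (htmono : ∀ k, 1 ≤ k → k < m → ts k < ts (k + 1))
    (htm : ts m < T - δ)
    (hbk : ∀ k, 1 ≤ k → k ≤ m → -1 < bs k)
    (k0 K0 : ℝ)
    (hk0 : k0 = sInf (impBeta ts bs m T δ '' Set.Icc (-r) T))
    (hK0 : K0 = sSup (impBeta ts bs m T δ '' Set.Icc (-r) T))
    (hH1 : ∀ φ : ℝ → ℝ, (∃ gφ : ℝ → ℝ, AbsContOn φ gφ (-r) 0) →
      ContinuousOn (fun t => f t (fun τ => impBeta ts bs m T δ (t + τ) * φ τ)) (Set.Icc 0 T))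
    (d : ℝ) (hd : 0 < d)
    (hH2 : ∀ φ : ℝ → ℝ, RegulatedOn φ (-r) 0 → d ≤ |φ 0| →
      ∀ t ∈ Set.Icc 0 T, 0 < φ 0 * f t (fun τ => impBeta ts bs m T δ (t + τ) * φ τ))
    (hH3 : B < k0 / K0)
    (b : ℝ) (hb0 : 0 < b) (hbb : b < (k0 - B * K0) / (T * k0))
    (hH4 : ∀ φ ψ : ℝ → ℝ, RegulatedOn φ (-r) 0 → RegulatedOn ψ (-r) 0 →
      ∀ t ∈ Set.Icc 0 T, |f t φ - f t ψ| ≤ b * |φ 0 - ψ 0|)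
    (S : ℝ) (hS : 0 < S)
    (hfS : ∀ t ∈ Set.Icc (0:ℝ) T, |f t (fun _ => (0:ℝ))| ≤ S)
    (lam : ℝ) (hlam0 : 0 < lam) (hlam1 : lam < 1)
    (x g : ℝ → ℝ)
    (hAC : AbsContOn x g 0 T) (hper : x 0 = x T)
    (heq : ∀ᵐ t ∂volume, t ∈ Set.Icc 0 T →
      g t + B * impBeta ts bs m T δ (t - δ) * pext T g (t - δ) / impBeta ts bs m T δ t
        = lam * f t (fun τ => impBeta ts bs m T δ (t + τ) * pext T x (t + τ)) / impBeta ts bs m T δ t)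
    :
    Real.sqrt (∫ t in (0:ℝ)..T, (g t) ^ 2)
      ≤ (b * d * k0 + S) * Real.sqrt T / (k0 - b * T * k0 - B * K0) := by
  have hr : 0 < r := hδ0.trans_lt hδr
  have hT : 0 < T := hr.trans_le hrT
  set β := impBeta ts bs m T δ with hβ
  have hβpos : ∀ t, 0 < β t := beta_pos ts bs m T δ hbk
  have hfin : (β '' Icc (-r) T).Finite := (beta_fin ts bs m T δ).subset (image_subset_range _ _)
  have hne : (β '' Icc (-r) T).Nonempty := ⟨_, mem_image_of_mem β (show (0:ℝ) ∈ Icc (-r) T from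
    ⟨by linarith, hT.le⟩)⟩
  have hkle : ∀ t ∈ Icc (-r) T, k0 ≤ β t := fun t ht => by
    rw [hk0]; exact csInf_le hfin.bddBelow (mem_image_of_mem β ht)
  have hleK : ∀ t ∈ Icc (-r) T, β t ≤ K0 := fun t ht => by
    rw [hK0]; exact le_csSup hfin.bddAbove (mem_image_of_mem β ht)
  have hk0pos : 0 < k0 := by
    obtain ⟨t, _, ht⟩ := hne.csInf_mem hfin
    rw [hk0, ← ht]; exact hβpos t
  have h0mem : (0:ℝ) ∈ Icc (-r) T := ⟨by linarith, hT.le⟩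
  have hkK : k0 ≤ K0 := (hkle 0 h0mem).trans (hleK 0 h0mem)
  have hK0pos : 0 < K0 := hk0pos.trans_le hkK
  have hden : 0 < k0 - b * T * k0 - B * K0 := by
    rw [lt_div_iff₀ (mul_pos hT hk0pos)] at hbb
    linarith
  have hRHS : 0 ≤ (b * d * k0 + S) * Real.sqrt T / (k0 - b * T * k0 - B * K0) := by positivity
  by_cases hg2 : IntervalIntegrable (fun t => g t ^ 2) volume 0 T
  swap
  · rw [intervalIntegral.integral_undef hg2, Real.sqrt_zero]
    exact hRHS
  have hgi : IntervalIntegrable g volume 0 T :=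
    (intervalIntegrable_iff_integrableOn_Icc_of_le hT.le).2 hAC.1
  have hxc : ContinuousOn x (Icc 0 T) := by
    have h1 : ContinuousOn (fun t => x 0 + ∫ s in (0:ℝ)..t, g s) (Icc 0 T) := by
      have := intervalIntegral.continuousOn_primitive_interval (μ := volume) (f := g)
        (a := 0) (b := T) (by rw [uIcc_of_le hT.le]; exact hAC.1)
      rw [uIcc_of_le hT.le] at this
      exact continuousOn_const.add this
    exact h1.congr fun t ht => hAC.2 t ht
  have hreg : ∀ t ∈ Icc 0 T, RegulatedOn (fun τ => pext T x (t + τ)) (-r) 0 := by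
    intro t ht
    apply reg_of_cont
    exact (pext_cont hT hxc hper).comp (by fun_prop)
      fun s hs => ⟨by linarith [hs.1, ht.1], by linarith [hs.2, ht.2]⟩
  have hpx : ∀ t ∈ Icc 0 T, pext T x (t + 0) = x t := by
    intro t ht
    unfold pext
    rw [add_zero, if_neg (not_lt.2 ht.1)]
  -- the periodic objects
  set gp := perExt T g with hgp
  set βp := perExt T β with hβp
  set G := perExt T (fun t => β t * g t) with hG
  set Φ : ℝ → ℝ := fun t => f t (fun τ => β (t + τ) * pext T x (t + τ)) with hΦ
  have hneT : ∀ᵐ t : ℝ, t ∉ ({T} : Set ℝ) := (Set.countable_singleton T).ae_notMem volume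
  have hβper : ∀ s : ℝ, -δ ≤ s → s < 0 → β s = β (s + T) := by
    intro s hs1 hs2
    rw [hβ]
    unfold impBeta
    rw [if_neg (by intro h; linarith [h.1]), if_neg (by intro h; linarith [h.2])]
  have hshift : ∀ t ∈ Ico 0 T, G (t - δ) = β (t - δ) * pext T g (t - δ) := by
    intro t ht
    rw [hG, perExt_pext hT _ ⟨by linarith [ht.1], by linarith [ht.2]⟩]
    unfold pext
    split_ifs with h
    · rw [hβper _ (by linarith [ht.1]) h]
    · rfl
  have hEq : ∀ᵐ t, t ∈ Ico 0 T → G t + B * G (t - δ) = lam * Φ t := by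
    filter_upwards [heq] with t ht hm
    have h1 := ht ⟨hm.1, hm.2.le⟩
    rw [hshift t hm, hG, perExt_eq hT _ hm]
    have hb' := (hβpos t).ne'
    simp only [hΦ]
    field_simp at h1
    linarith
  have hβpk : ∀ t, βp t ∈ Icc k0 K0 := by
    intro t
    have h1 := Int.fract_nonneg (t / T)
    have h2 := Int.fract_lt_one (t / T)
    have hm : Int.fract (t / T) * T ∈ Icc (-r) T := ⟨by nlinarith, by nlinarith⟩
    exact ⟨hkle _ hm, hleK _ hm⟩
  have hGfi : IntervalIntegrable (fun t => β t * g t) volume 0 T := by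
    have hgi' := hgi
    rw [intervalIntegrable_iff] at hgi' ⊢
    refine Integrable.bdd_mul (c := K0) hgi' (beta_meas ts bs m T δ).aestronglyMeasurable ?_
    refine (ae_restrict_iff' measurableSet_uIoc).2 (Eventually.of_forall fun t ht => ?_)
    rw [uIoc_of_le hT.le] at ht
    rw [Real.norm_eq_abs, abs_of_pos (hβpos t)]
    exact hleK t ⟨by linarith [ht.1], ht.2⟩
  have hGi := perExt_int hT hGfi
  have hint0 : ∫ t in (0:ℝ)..T, g t = 0 := by
    have := hAC.2 T ⟨hT.le, le_rfl⟩
    linarith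
  -- existence of a point where `|x| < d`
  have hkey : ∀ σ : ℝ, (∀ t ∈ Icc 0 T, d ≤ |x t|) → (∀ t ∈ Icc 0 T, 0 < σ * x t) → False := by
    intro σ hdx hσ
    have hGper := perExt_periodic hT (fun t => β t * g t)
    have := aux_pos (δ := δ) hT hB0 hk0pos hkK hH3 (fun t => σ * G t) βp
      (fun t => by simp only [hG, hGper t]) (perExt_periodic hT β)
      (perExt_meas (beta_meas ts bs m T δ)) (fun t => (hβpk t).1) (fun t => (hβpk t).2)
      (hGi.const_mul σ) (by
        filter_upwards [hEq, hneT] with t h1 h2 hm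
        have hm' : t ∈ Ico 0 T := ⟨hm.1.le, lt_of_le_of_ne hm.2 h2⟩
        have hm'' : t ∈ Icc 0 T := ⟨hm.1.le, hm.2⟩
        have h3 := hH2 _ (hreg t hm'') (by simp only [hpx t hm'']; exact hdx t hm'') t hm''
        simp only [hpx t hm''] at h3
        have h4 := mul_pos (hσ t hm'') h3
        have h5 : 0 < σ * Φ t := by
          have e : σ * x t * (x t * f t (fun τ => β (t + τ) * pext T x (t + τ)))
            = (σ * Φ t) * (x t) ^ 2 := by simp only [hΦ]; ring
          rw [e] at h4
          exact pos_of_mul_pos_left h4 (sq_nonneg _)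
        have e : σ * G t + B * (σ * G (t - δ)) = lam * (σ * Φ t) := by
          linear_combination σ * h1 hm'
        rw [e]
        exact mul_pos hlam0 h5)
    have e : ∫ t in (0:ℝ)..T, (βp t)⁻¹ * (σ * G t) = ∫ t in (0:ℝ)..T, σ * g t := by
      apply intervalIntegral.integral_congr_ae
      filter_upwards [hneT] with t h2 hm
      rw [uIoc_of_le hT.le] at hm
      have hm' : t ∈ Ico 0 T := ⟨hm.1.le, lt_of_le_of_ne hm.2 h2⟩
      rw [hβp, hG, perExt_eq hT _ hm', perExt_eq hT _ hm']
      have := (hβpos t).ne'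
      field_simp
    rw [e, intervalIntegral.integral_const_mul, hint0, mul_zero] at this
    exact lt_irrefl _ this
  have hξ : ∃ ξ ∈ Icc 0 T, |x ξ| < d := by
    by_contra hcon
    push Not at hcon
    have hx0 : ∀ t ∈ Icc 0 T, x t ≠ 0 := by
      intro t ht h
      have := hcon t ht
      rw [h, abs_zero] at this
      linarith
    have hm0 : (0:ℝ) ∈ Icc 0 T := ⟨le_rfl, hT.le⟩
    rcases lt_or_gt_of_ne (hx0 0 hm0) with h | h
    · refine hkey (-1) hcon fun t ht => ?_
      by_contra hn
      obtain ⟨s, hs, hs0⟩ := isPreconnected_Icc.intermediate_value hm0 ht hxc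
        (show (0:ℝ) ∈ Icc (x 0) (x t) from ⟨h.le, by linarith⟩)
      exact hx0 s hs hs0
    · refine hkey 1 hcon fun t ht => ?_
      by_contra hn
      obtain ⟨s, hs, hs0⟩ := isPreconnected_Icc.intermediate_value ht hm0 hxc
        (show (0:ℝ) ∈ Icc (x t) (x 0) from ⟨by linarith, h.le⟩)
      exact hx0 s hs hs0
  obtain ⟨ξ, hξm, hξd⟩ := hξ
  have hcs := aux_CS hT hgi hg2
  set N := √(∫ t in (0:ℝ)..T, g t ^ 2) with hN
  have hN0 : 0 ≤ N := Real.sqrt_nonneg _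
  have hxb : ∀ t ∈ Icc 0 T, |x t| ≤ d + √T * N := by
    intro t ht
    have hsub : ∀ s ∈ Icc 0 T, IntervalIntegrable g volume 0 s := fun s hs =>
      hgi.mono_set (by rw [uIcc_of_le hs.1, uIcc_of_le hT.le]; exact Icc_subset_Icc_right hs.2)
    have h1 : x t - x ξ = ∫ s in ξ..t, g s := by
      rw [hAC.2 t ht, hAC.2 ξ hξm,
        ← intervalIntegral.integral_interval_sub_left (hsub t ht) (hsub ξ hξm)]
      ring
    have h2 : |∫ s in ξ..t, g s| ≤ ∫ s in (0:ℝ)..T, |g s| := by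
      have h3 := intervalIntegral.norm_integral_le_integral_norm_uIoc (f := g) (a := ξ) (b := t)
        (μ := volume)
      simp only [Real.norm_eq_abs] at h3
      refine h3.trans ?_
      rw [intervalIntegral.integral_of_le hT.le]
      refine setIntegral_mono_set ?_ (Eventually.of_forall fun s => abs_nonneg _) ?_
      · exact ((intervalIntegrable_iff_integrableOn_Ioc_of_le hT.le).1 hgi.abs)
      · refine HasSubset.Subset.eventuallyLE ?_
        intro s hs
        rw [mem_uIoc] at hs
        rcases hs with hs | hs
        · exact ⟨hξm.1.trans_lt hs.1, hs.2.trans ht.2⟩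
        · exact ⟨ht.1.trans_lt hs.1, hs.2.trans hξm.2⟩
    rw [← h1] at h2
    have h4 := abs_sub_abs_le_abs_sub (x t) (x ξ)
    linarith
  set C : ℝ := S / k0 + b * (d + √T * N) with hC
  have hC0 : 0 ≤ C := by positivity
  have hα0 : 0 ≤ B * K0 / k0 := by positivity
  have hΦb : ∀ t ∈ Icc 0 T, |Φ t| ≤ S + b * (β t * (d + √T * N)) := by
    intro t ht
    have h1 := hH4 (fun τ => β (t + τ) * pext T x (t + τ)) (fun _ => 0)
      (reg_mul (reg_beta ts bs m T δ _ _ t) (hreg t ht)) (reg_of_cont continuousOn_const) t ht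
    simp only [hpx t ht, sub_zero, abs_mul] at h1
    rw [add_zero, abs_of_pos (hβpos t)] at h1
    have h2 := hfS t ht
    have h3 := abs_sub_abs_le_abs_sub (Φ t) (f t (fun _ => 0))
    have h4 : b * (β t * |x t|) ≤ b * (β t * (d + √T * N)) :=
      mul_le_mul_of_nonneg_left (mul_le_mul_of_nonneg_left (hxb t ht) (hβpos t).le) hb0.le
    simp only [hΦ] at h3 ⊢
    linarith
  have hgper := perExt_periodic hT g
  have hgp2 : IntervalIntegrable (fun t => gp t ^ 2) volume 0 T := perExt_int hT hg2
  have hfinal := aux_L2 (g := g) (h := fun t => gp (t - δ)) hT hα0 hC0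
    (aux_shift_int hT hgper (perExt_int hT hgi)) hg2
    (aux_shift_int (δ := δ) (h := fun t => gp t ^ 2) hT
      (fun t => by simp only [hgp, hgper t]) hgp2)
    (by
      rw [aux_shift (δ := δ) (h := fun t => gp t ^ 2) (fun t => by simp only [hgp, hgper t])]
      exact perExt_integral hT (fun t => g t ^ 2))
    (by
      filter_upwards [hEq, hneT] with t h1 h2 hm
      have hm' : t ∈ Ico 0 T := ⟨hm.1, lt_of_le_of_ne hm.2 h2⟩
      have h3 := h1 hm'
      rw [hshift t hm', hG, perExt_eq hT _ hm',
        ← perExt_pext hT g ⟨by linarith [hm.1], by linarith [hm'.2]⟩] at h3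
      have h4 := hΦb t hm
      have hk := hkle t ⟨by linarith [hm.1], hm.2⟩
      have hK := hleK (t - δ) ⟨by linarith [hm.1], by linarith [hm.2]⟩
      have h5 : β t * |g t| ≤ B * (K0 * |gp (t - δ)|) + (S + b * (β t * (d + √T * N))) := by
        have e : β t * g t = lam * Φ t - B * (β (t - δ) * gp (t - δ)) := by
          simp only [hgp]; linarith
        have e2 : β t * |g t| = |β t * g t| := by rw [abs_mul, abs_of_pos (hβpos t)]
        rw [e2, e]
        refine (abs_sub _ _).trans ?_
        rw [abs_mul, abs_mul, abs_mul, abs_of_pos hlam0, abs_of_nonneg hB0, abs_of_pos (hβpos _)]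
        have i1 : lam * |Φ t| ≤ |Φ t| := by nlinarith [abs_nonneg (Φ t)]
        have i2 : B * (β (t - δ) * |gp (t - δ)|) ≤ B * (K0 * |gp (t - δ)|) := by gcongr
        linarith
      have h6 : |g t| ≤ (B * (K0 * |gp (t - δ)|) + S) / β t + b * (d + √T * N) := by
        rw [← sub_le_iff_le_add, le_div_iff₀ (hβpos t)]
        linarith
      have h7 : (B * (K0 * |gp (t - δ)|) + S) / β t ≤ (B * (K0 * |gp (t - δ)|) + S) / k0 := by
        gcongr
      have e : (B * (K0 * |gp (t - δ)|) + S) / k0 = B * K0 / k0 * |gp (t - δ)| + S / k0 := by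
        ring
      rw [hC]
      linarith)
  rw [← hN] at hfinal
  rw [le_div_iff₀ hden]
  have hs2 : √T * √T = T := Real.mul_self_sqrt hT.le
  have h8 := mul_le_mul_of_nonneg_left hfinal hk0pos.le
  have e : k0 * (B * K0 / k0 * N + C * √T) =
      B * K0 * N + S * √T + b * d * k0 * √T + b * k0 * N * (√T * √T) := by
    rw [hC]; field_simp; ring
  rw [e, hs2] at h8
  linarith
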